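/- Let 𝒢 be an ultragraph with at least one edge, 𝔽 the free group on 𝒢¹, and R a nonzero unital commutative ring. Then L_R(𝒢) is epsilon-strongly 𝔽-graded with respect to the grading {L_R(𝒢)_g}_{g∈𝔽} if and only if G⁰ ∈ 𝒢⁰. -/

import Mathlib

/-- An ultragraph: a source map `src : E → V` and a range map assigning to each
edge a nonempty set of vertices. -/
structure Ultragraph (V : Type) (E : Type) : Type where
  src : E → V
  rng : E → Set V
  rng_nonempty : ∀ e, (rng e).Nonempty

namespace Ultragraph

variable {V E : Type}

/-- A finite path: a (possibly empty) list of edges with compatible transitions. -/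
def IsPath (G : Ultragraph V E) (es : List E) : Prop :=
  es.Chain' fun e f => G.src f ∈ G.rng e

/-- An infinite path. -/
def IsInfinitePath (G : Ultragraph V E) (p : ℕ → E) : Prop :=
  ∀ i : ℕ, G.src (p (i + 1)) ∈ G.rng (p i)

/-- Condition (Y). -/
def ConditionY (G : Ultragraph V E) : Prop :=
  ∀ p : ℕ → E, G.IsInfinitePath p →
    ∃ (k : ℕ) (α : List E) (hα : α ≠ []),
      α.length = k + 1 ∧ G.IsPath α ∧ G.src (p k) ∈ G.rng (α.getLast hα)

/-- The collection 𝒢⁰ of generalized vertices: the smallest collection of subsets of `V`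
containing the singletons and the ranges of edges, closed under finite unions and finite
intersections (the empty set is included for convenience; `p_∅ = 0`). -/
inductive InG0 (G : Ultragraph V E) : Set V → Prop
  | vertex (v : V) : InG0 G {v}
  | range (e : E) : InG0 G (G.rng e)
  | union {A B : Set V} : InG0 G A → InG0 G B → InG0 G (A ∪ B)
  | inter {A B : Set V} : InG0 G A → InG0 G B → InG0 G (A ∩ B)

/-- Generators of the Leavitt path algebra. -/
inductive LPAGen (G : Ultragraph V E) : Type
  | edge : E → LPAGen G
  | star : E → LPAGen G
  | proj : (A : Set V) → G.InG0 A → LPAGen G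

/-- The directed graph `E_𝒢` associated to an ultragraph, viewed again as an ultragraph
whose edge ranges are singletons. -/
def toGraph (G : Ultragraph V E) : Ultragraph V {q : E × V // q.2 ∈ G.rng q.1} where
  src q := G.src q.1.1
  rng q := {q.1.2}
  rng_nonempty q := ⟨q.1.2, rfl⟩

variable (R : Type) [CommRing R] (G : Ultragraph V E)

/-- The free `R`-algebra on the generators. -/
abbrev FA := FreeAlgebra R (LPAGen G)

/-- The generator `g` inside the free algebra. -/
def X (g : LPAGen G) : FA R G := FreeAlgebra.ι R g

/-- The defining relations of the Leavitt path algebra of an ultragraph. -/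
inductive LeavittRel : FA R G → FA R G → Prop
  | proj_empty (h : G.InG0 ∅) : LeavittRel (X R G (.proj ∅ h)) 0
  | proj_mul (A B : Set V) (hA : G.InG0 A) (hB : G.InG0 B) :
      LeavittRel (X R G (.proj A hA) * X R G (.proj B hB))
        (X R G (.proj (A ∩ B) (hA.inter hB)))
  | proj_union (A B : Set V) (hA : G.InG0 A) (hB : G.InG0 B) :
      LeavittRel (X R G (.proj (A ∪ B) (hA.union hB)))
        (X R G (.proj A hA) + X R G (.proj B hB) - X R G (.proj (A ∩ B) (hA.inter hB)))
  | src_mul (e : E) :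
      LeavittRel (X R G (.proj {G.src e} (InG0.vertex (G.src e))) * X R G (.edge e))
        (X R G (.edge e))
  | mul_rng (e : E) :
      LeavittRel (X R G (.edge e) * X R G (.proj (G.rng e) (InG0.range e)))
        (X R G (.edge e))
  | rng_mul_star (e : E) :
      LeavittRel (X R G (.proj (G.rng e) (InG0.range e)) * X R G (.star e))
        (X R G (.star e))
  | star_mul_src (e : E) :
      LeavittRel (X R G (.star e) * X R G (.proj {G.src e} (InG0.vertex (G.src e))))
        (X R G (.star e))
  | star_mul_same (e : E) :
      LeavittRel (X R G (.star e) * X R G (.edge e))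
        (X R G (.proj (G.rng e) (InG0.range e)))
  | star_mul_ne (e f : E) (h : e ≠ f) :
      LeavittRel (X R G (.star e) * X R G (.edge f)) 0
  | ck (v : V) (hfin : {e : E | G.src e = v}.Finite) (hne : {e : E | G.src e = v}.Nonempty) :
      LeavittRel (X R G (.proj {v} (InG0.vertex v)))
        (∑ e ∈ hfin.toFinset, X R G (.edge e) * X R G (.star e))

/-- The (unital) quotient of the free algebra by the Leavitt relations; the Leavitt
path algebra `L_R(𝒢)` sits inside it as the non-unital subalgebra generated by the
generators. -/
abbrev LPABig := RingQuot (LeavittRel R G)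

/-- The image of a generator in the quotient. -/
def gen (g : LPAGen G) : LPABig R G := RingQuot.mkAlgHom R (LeavittRel R G) (X R G g)

/-- `s_e`. -/
def sgen (e : E) : LPABig R G := gen R G (.edge e)

/-- `s_e^*`. -/
def tgen (e : E) : LPABig R G := gen R G (.star e)

/-- `p_A`. -/
def pgen (A : Set V) (hA : G.InG0 A) : LPABig R G := gen R G (.proj A hA)

/-- `s_α` for a finite path `α` (the empty product is `1` in the ambient algebra). -/
def sPath (es : List E) : LPABig R G := (es.map (sgen R G)).prod

/-- `s_β^*` for a finite path `β`. -/
def tPath (es : List E) : LPABig R G := (es.reverse.map (tgen R G)).prod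

/-- The monomial `s_α p_A s_β^*`. -/
def mono (α : List E) (A : Set V) (hA : G.InG0 A) (β : List E) : LPABig R G :=
  sPath R G α * pgen R G A hA * tPath R G β

/-- The `m`-th component of the canonical `ℤ`-grading: all finite `R`-linear combinations
of monomials `s_α p_A s_β^*` with `|α| - |β| = m`. -/
def zComp (m : ℤ) : AddSubgroup (LPABig R G) :=
  AddSubgroup.closure {x | ∃ (l : R) (α β : List E) (A : Set V) (hA : G.InG0 A),
    G.IsPath α ∧ G.IsPath β ∧ (α.length : ℤ) - (β.length : ℤ) = m ∧
    x = l • mono R G α A hA β}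

/-- The element of the free group on the edges determined by a finite path. -/
def pathWord (es : List E) : FreeGroup E := (es.map FreeGroup.of).prod

/-- The `g`-th component of the free-group grading: all finite `R`-linear combinations
of monomials `s_α p_A s_β^*` with `α β⁻¹ = g` in the free group on the edges. -/
def fComp (g : FreeGroup E) : AddSubgroup (LPABig R G) :=
  AddSubgroup.closure {x | ∃ (l : R) (α β : List E) (A : Set V) (hA : G.InG0 A),
    G.IsPath α ∧ G.IsPath β ∧ pathWord α * (pathWord β)⁻¹ = g ∧
    x = l • mono R G α A hA β}

/-- The set of generators inside the quotient. -/
def genSet : Set (LPABig R G) := Set.range (gen R G)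

/-- The Leavitt path algebra `L_R(𝒢)`: the non-unital subalgebra of the quotient
generated by the images of the generators. -/
def LPA : NonUnitalSubalgebra R (LPABig R G) := NonUnitalAlgebra.adjoin R (genSet R G)

/-- `s_e` as an element of `L_R(𝒢)`. -/
def sEl (e : E) : LPA R G :=
  ⟨sgen R G e, NonUnitalAlgebra.subset_adjoin R ⟨LPAGen.edge e, rfl⟩⟩

/-- `s_e^*` as an element of `L_R(𝒢)`. -/
def tEl (e : E) : LPA R G :=
  ⟨tgen R G e, NonUnitalAlgebra.subset_adjoin R ⟨LPAGen.star e, rfl⟩⟩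

/-- `p_A` as an element of `L_R(𝒢)`. -/
def pEl (A : Set V) (hA : G.InG0 A) : LPA R G :=
  ⟨pgen R G A hA, NonUnitalAlgebra.subset_adjoin R ⟨LPAGen.proj A hA, rfl⟩⟩

end Ultragraph

/-- The additive span of the set of products `{a b : a ∈ S, b ∈ T}`. -/
def mulSpan {A : Type} [AddGroup A] [Mul A] (S T : AddSubgroup A) : AddSubgroup A :=
  AddSubgroup.closure {x | ∃ a ∈ S, ∃ b ∈ T, x = a * b}

namespace Ultragraph

variable {R : Type} [CommRing R] {G : Ultragraph V E}

section Relations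

theorem pgen_congr {A B : Set V} (h : A = B) (hA : G.InG0 A) (hB : G.InG0 B) :
    pgen R G A hA = pgen R G B hB := by
  subst h; rfl

theorem pgen_empty (h : G.InG0 ∅) : pgen R G ∅ h = 0 := by
  simpa [pgen, sgen, tgen, gen] using
    RingQuot.mkAlgHom_rel R (LeavittRel.proj_empty (R := R) h)

theorem pgen_mul {A B : Set V} (hA : G.InG0 A) (hB : G.InG0 B) :
    pgen R G A hA * pgen R G B hB = pgen R G (A ∩ B) (hA.inter hB) := by
  simpa [pgen, sgen, tgen, gen] using
    RingQuot.mkAlgHom_rel R (LeavittRel.proj_mul (R := R) A B hA hB)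

theorem pgen_src_mul_sgen (e : E) :
    pgen R G {G.src e} (InG0.vertex _) * sgen R G e = sgen R G e := by
  simpa [pgen, sgen, tgen, gen] using
    RingQuot.mkAlgHom_rel R (LeavittRel.src_mul (R := R) (G := G) e)

theorem sgen_mul_pgen_rng (e : E) :
    sgen R G e * pgen R G (G.rng e) (InG0.range e) = sgen R G e := by
  simpa [pgen, sgen, tgen, gen] using
    RingQuot.mkAlgHom_rel R (LeavittRel.mul_rng (R := R) (G := G) e)

theorem pgen_rng_mul_tgen (e : E) :
    pgen R G (G.rng e) (InG0.range e) * tgen R G e = tgen R G e := by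
  simpa [pgen, sgen, tgen, gen] using
    RingQuot.mkAlgHom_rel R (LeavittRel.rng_mul_star (R := R) (G := G) e)

theorem tgen_mul_pgen_src (e : E) :
    tgen R G e * pgen R G {G.src e} (InG0.vertex _) = tgen R G e := by
  simpa [pgen, sgen, tgen, gen] using
    RingQuot.mkAlgHom_rel R (LeavittRel.star_mul_src (R := R) (G := G) e)

theorem tgen_mul_sgen (e : E) :
    tgen R G e * sgen R G e = pgen R G (G.rng e) (InG0.range e) := by
  simpa [pgen, sgen, tgen, gen] using
    RingQuot.mkAlgHom_rel R (LeavittRel.star_mul_same (R := R) (G := G) e)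

theorem pgen_commute {A B : Set V} (hA : G.InG0 A) (hB : G.InG0 B) :
    Commute (pgen R G A hA) (pgen R G B hB) := by
  rw [commute_iff_eq, pgen_mul, pgen_mul]
  exact pgen_congr (Set.inter_comm A B) _ _

theorem pgen_mul_sgen {A : Set V} (hA : G.InG0 A) {e : E} (h : G.src e ∈ A) :
    pgen R G A hA * sgen R G e = sgen R G e := by
  rw [← pgen_src_mul_sgen, ← mul_assoc, pgen_mul,
    pgen_congr (Set.inter_eq_right.2 (Set.singleton_subset_iff.2 h))]

theorem pgen_mul_sgen_of_notMem {A : Set V} (hA : G.InG0 A) {e : E} (h : G.src e ∉ A) :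
    pgen R G A hA * sgen R G e = 0 := by
  have h' : A ∩ {G.src e} = ∅ := Set.inter_singleton_eq_empty.2 h
  rw [← pgen_src_mul_sgen, ← mul_assoc, pgen_mul,
    pgen_congr h' _ (h' ▸ hA.inter (InG0.vertex _)), pgen_empty, zero_mul]

theorem tgen_mul_pgen {A : Set V} (hA : G.InG0 A) {e : E} (h : G.src e ∈ A) :
    tgen R G e * pgen R G A hA = tgen R G e := by
  rw [← tgen_mul_pgen_src, mul_assoc, pgen_mul,
    pgen_congr (Set.inter_eq_left.2 (Set.singleton_subset_iff.2 h))]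

theorem tgen_mul_pgen_of_notMem {A : Set V} (hA : G.InG0 A) {e : E} (h : G.src e ∉ A) :
    tgen R G e * pgen R G A hA = 0 := by
  have h' : {G.src e} ∩ A = ∅ := Set.singleton_inter_eq_empty.2 h
  rw [← tgen_mul_pgen_src, mul_assoc, pgen_mul,
    pgen_congr h' _ (h' ▸ (InG0.vertex _).inter hA), pgen_empty, mul_zero]

theorem pgen_mul_pgen_vertex_of_notMem {A : Set V} (hA : G.InG0 A) {v : V} (h : v ∉ A) :
    pgen R G A hA * pgen R G {v} (InG0.vertex v) = 0 := by
  have h' : A ∩ {v} = ∅ := Set.inter_singleton_eq_empty.2 h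
  rw [pgen_mul, pgen_congr h' _ (h' ▸ hA.inter (InG0.vertex _)), pgen_empty]

end Relations

section Monomials

theorem sPath_cons (e : E) (es : List E) :
    sPath R G (e :: es) = sgen R G e * sPath R G es := by
  simp [sPath]

theorem tPath_cons (e : E) (es : List E) :
    tPath R G (e :: es) = tPath R G es * tgen R G e := by
  simp [tPath]

theorem sPath_append (a b : List E) :
    sPath R G (a ++ b) = sPath R G a * sPath R G b := by
  simp [sPath]

theorem tPath_append (a b : List E) :
    tPath R G (a ++ b) = tPath R G b * tPath R G a := by
  simp [tPath]

/-- `p_B` commutes with the diagonal monomials `s_γ p_A s_γ^*`. -/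
theorem pgen_commute_mono {A B : Set V} (hB : G.InG0 B) (γ : List E) (hA : G.InG0 A) :
    Commute (pgen R G B hB) (mono R G γ A hA γ) := by
  cases γ with
  | nil => simpa [mono, sPath, tPath] using pgen_commute hB hA
  | cons e γ =>
    rw [commute_iff_eq, mono, sPath_cons, tPath_cons]
    by_cases h : G.src e ∈ B
    · simp only [← mul_assoc, pgen_mul_sgen hB h]
      simp only [mul_assoc, tgen_mul_pgen hB h]
    · simp only [← mul_assoc, pgen_mul_sgen_of_notMem hB h]
      simp only [mul_assoc, tgen_mul_pgen_of_notMem hB h, zero_mul, mul_zero]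

theorem pgen_univ_mul_mono (hU : G.InG0 Set.univ) {A : Set V} (γ : List E) (hA : G.InG0 A)
    (β : List E) : pgen R G Set.univ hU * mono R G γ A hA β = mono R G γ A hA β := by
  cases γ with
  | nil =>
    simp only [mono, sPath, List.map_nil, List.prod_nil, one_mul, ← mul_assoc, pgen_mul]
    rw [pgen_congr (Set.univ_inter A)]
  | cons e γ =>
    simp only [mono, sPath_cons, ← mul_assoc, pgen_mul_sgen hU (Set.mem_univ _)]

theorem tPath_mul_sPath_cons (e : E) (es : List E) (h : G.IsPath (e :: es)) :
    ∃ (B : Set V) (hB : G.InG0 B),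
      tPath R G (e :: es) * sPath R G (e :: es) = pgen R G B hB ∧
      sPath R G (e :: es) * pgen R G B hB = sPath R G (e :: es) ∧
      pgen R G B hB * tPath R G (e :: es) = tPath R G (e :: es) := by
  induction es generalizing e with
  | nil =>
    exact ⟨G.rng e, InG0.range e, by simp [sPath, tPath, tgen_mul_sgen],
      by simp [sPath, sgen_mul_pgen_rng], by simp [tPath, pgen_rng_mul_tgen]⟩
  | cons f es ih =>
    obtain ⟨hef, hf⟩ := List.isChain_cons_cons.1 h
    obtain ⟨B, hB, h1, h2, h3⟩ := ih f hf
    refine ⟨B, hB, ?_, ?_, ?_⟩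
    · rw [← h1, sPath_cons e, tPath_cons e, mul_assoc, ← mul_assoc (tgen R G e), tgen_mul_sgen,
        sPath_cons f, ← mul_assoc (pgen R G _ _), pgen_mul_sgen _ hef]
    · rw [sPath_cons e, mul_assoc, h2]
    · rw [tPath_cons e, ← mul_assoc, h3]

/-- For a path `α`, the element `s_α^* s_α` is `1` or some `p_B`. -/
theorem tPath_mul_sPath (α : List E) (h : G.IsPath α) :
    (tPath R G α * sPath R G α = 1 ∨
      ∃ (B : Set V) (hB : G.InG0 B), tPath R G α * sPath R G α = pgen R G B hB) ∧
    sPath R G α * (tPath R G α * sPath R G α) = sPath R G α ∧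
    (tPath R G α * sPath R G α) * tPath R G α = tPath R G α := by
  cases α with
  | nil => simp [sPath, tPath]
  | cons e es =>
    obtain ⟨B, hB, h1, h2, h3⟩ := tPath_mul_sPath_cons (R := R) e es h
    rw [h1]
    exact ⟨.inr ⟨B, hB, rfl⟩, h2, h3⟩

theorem tPath_mul_sPath_commute_mono {A : Set V} {α : List E} (h : G.IsPath α) (γ : List E)
    (hA : G.InG0 A) : Commute (tPath R G α * sPath R G α) (mono R G γ A hA γ) := by
  obtain h1 | ⟨B, hB, h1⟩ := (tPath_mul_sPath (R := R) α h).1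
  · rw [h1]; exact Commute.one_left _
  · rw [h1]; exact pgen_commute_mono hB γ hA

theorem mono_append (a b γ : List E) {A : Set V} (hA : G.InG0 A) :
    mono R G (a ++ γ) A hA (b ++ γ) = sPath R G a * mono R G γ A hA γ * tPath R G b := by
  simp only [mono, sPath_append, tPath_append, mul_assoc]

end Monomials

section FreeGroupWords

/-- The word `a b⁻¹` over the edges and their formal inverses. -/
def diffWord (a b : List E) : List (E × Bool) :=
  a.map (·, true) ++ (b.map (·, false)).reverse

theorem mk_diffWord (a b : List E) :
    FreeGroup.mk (diffWord a b) = pathWord a * (pathWord b)⁻¹ := by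
  have h : ∀ l : List E, pathWord l = FreeGroup.mk (l.map (·, true)) := by
    intro l
    induction l with
    | nil => rfl
    | cons e l ih =>
      rw [pathWord, List.map_cons, List.prod_cons, ← pathWord, ih]
      rfl
  rw [h, h, FreeGroup.inv_mk, FreeGroup.mul_mk, diffWord, FreeGroup.invRev]
  simp [Function.comp_def]

theorem diffWord_injective {a b a' b' : List E} (h : diffWord a b = diffWord a' b') :
    a = a' ∧ b = b' := by
  constructor
  · have := congrArg (fun l => (l.filter (·.2)).map Prod.fst) h
    simpa [diffWord, List.filter_map, Function.comp_def] using this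
  · have := congrArg (fun l => (l.filter (!·.2)).map Prod.fst) h
    simpa [diffWord, List.filter_map, Function.comp_def] using this

theorem exists_reduced_decomposition (α : List E) : ∀ β : List E, ∃ a b γ : List E,
    α = a ++ γ ∧ β = b ++ γ ∧ FreeGroup.IsReduced (diffWord a b) := by
  have hred : ∀ a b : List E, (∀ e ∈ a.getLast?, e ∉ b.getLast?) →
      FreeGroup.IsReduced (diffWord a b) := by
    intro a b h
    unfold FreeGroup.IsReduced diffWord
    rw [List.isChain_append, List.isChain_reverse, List.isChain_map, List.isChain_map]
    refine ⟨(List.pairwise_of_forall (by simp)).isChain,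
      (List.pairwise_of_forall (by simp)).isChain, ?_⟩
    intro x hx y hy hxy
    simp only [List.getLast?_map, List.head?_reverse, Option.mem_def, Option.map_eq_some_iff]
      at hx hy
    obtain ⟨e, he, rfl⟩ := hx
    obtain ⟨f, hf, rfl⟩ := hy
    obtain rfl : e = f := hxy
    exact absurd hf (h e he)
  induction α using List.reverseRecOn with
  | nil => exact fun β => ⟨[], β, [], by simp, by simp, hred _ _ (by simp)⟩
  | append_singleton α e ih =>
    intro β
    by_cases he : e ∈ β.getLast?
    · obtain ⟨β, rfl⟩ := List.getLast?_eq_some_iff.1 he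
      obtain ⟨a, b, γ, rfl, rfl, h⟩ := ih β
      exact ⟨a, b, γ ++ [e], by simp, by simp, h⟩
    · refine ⟨α ++ [e], β, [], by simp, by simp, hred _ _ ?_⟩
      simpa using he

theorem diffWord_unique {a b a' b' : List E} (h : FreeGroup.IsReduced (diffWord a b))
    (h' : FreeGroup.IsReduced (diffWord a' b'))
    (heq : pathWord a * (pathWord b)⁻¹ = pathWord a' * (pathWord b')⁻¹) :
    a = a' ∧ b = b' := by
  classical
  rw [← mk_diffWord, ← mk_diffWord] at heq
  have := congrArg FreeGroup.toWord heq
  rw [FreeGroup.toWord_mk, FreeGroup.toWord_mk, h.reduce_eq, h'.reduce_eq] at this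
  exact diffWord_injective this

theorem pathWord_append (a b : List E) : pathWord (a ++ b) = pathWord a * pathWord b := by
  simp [pathWord]

end FreeGroupWords

section Components

theorem tPath_mul_sPath_commute_pgen {B : Set V} (hB : G.InG0 B) {α : List E}
    (h : G.IsPath α) : Commute (pgen R G B hB) (tPath R G α * sPath R G α) := by
  simpa [mono, sPath, tPath] using (tPath_mul_sPath_commute_mono (R := R) h [] hB).symm

theorem tPath_mul_sPath_commute {α β : List E} (hα : G.IsPath α) (hβ : G.IsPath β) :
    Commute (tPath R G α * sPath R G α) (tPath R G β * sPath R G β) := by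
  obtain h1 | ⟨B, hB, h1⟩ := (tPath_mul_sPath (R := R) α hα).1
  · rw [h1]; exact Commute.one_left _
  · rw [h1]; exact tPath_mul_sPath_commute_pgen hB hβ

theorem mul_identities {M : Type*} [Monoid M] {s t s' t' u x : M}
    (hx' : Commute (t' * s') x) (hq : Commute (t * s) (t' * s'))
    (hs : s * (t * s) = s) (ht : t * s * t = t)
    (hs' : s' * (t' * s') = s') (ht' : t' * s' * t' = t') (hux : u * x = x)
    (hxu : x * u = x) (hu : Commute u (t * s)) (hu' : Commute u (t' * s')) :
    (s * u * t') * (s' * u * t) * (s * x * t') = s * x * t' ∧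
    (s' * x * t) * ((s * u * t') * (s' * u * t)) = s' * x * t := by
  constructor
  · calc (s * u * t') * (s' * u * t) * (s * x * t')
        = s * ((u * (t' * s')) * ((u * (t * s)) * x)) * t' := by simp only [mul_assoc]
      _ = s * (((t' * s') * u) * (((t * s) * u) * x)) * t' := by rw [hu'.eq, hu.eq]
      _ = s * ((t' * s') * ((u * (t * s)) * (u * x))) * t' := by simp only [mul_assoc]
      _ = s * ((t' * s') * ((t * s) * (u * x))) * t' := by
          rw [hux, hu.eq, mul_assoc (t * s) u x, hux]
      _ = s * (((t * s) * (t' * s')) * x) * t' := by rw [hux, hq.eq]; simp only [mul_assoc]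
      _ = s * ((t * s) * (x * (t' * s'))) * t' := by rw [mul_assoc (t * s), hx'.eq]
      _ = (s * (t * s)) * x * ((t' * s') * t') := by simp only [mul_assoc]
      _ = s * x * t' := by rw [hs, ht']
  · calc (s' * x * t) * ((s * u * t') * (s' * u * t))
        = s' * (x * ((t * s) * u) * ((t' * s') * u)) * t := by simp only [mul_assoc]
      _ = s' * ((x * u) * (t * s) * u * (t' * s')) * t := by
          rw [← hu'.eq, ← hu.eq]; simp only [mul_assoc]
      _ = s' * ((x * u) * (t * s) * (t' * s')) * t := by
          rw [hxu, mul_assoc x _ u, ← hu.eq, ← mul_assoc x, hxu]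
      _ = s' * (x * ((t' * s') * (t * s))) * t := by rw [hxu, ← hq.eq]; simp only [mul_assoc]
      _ = s' * ((t' * s') * x * (t * s)) * t := by rw [← mul_assoc x, hx'.eq]
      _ = (s' * (t' * s')) * x * ((t * s) * t) := by simp only [mul_assoc]
      _ = s' * x * t := by rw [hs', ht]

theorem mono_mem_fComp {α β : List E} (hα : G.IsPath α) (hβ : G.IsPath β) {A : Set V}
    (hA : G.InG0 A) : mono R G α A hA β ∈ fComp R G (pathWord α * (pathWord β)⁻¹) :=
  AddSubgroup.subset_closure ⟨1, α, β, A, hA, hα, hβ, rfl, (one_smul _ _).symm⟩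

/-- If `ε` fixes all the monomials spanning `L_R(𝒢)_g` under left multiplication, it fixes
all of `L_R(𝒢)_g`. -/
theorem mul_eq_of_mem_fComp {g : FreeGroup E} {ε : LPABig R G}
    (h : ∀ (α β : List E) (A : Set V) (hA : G.InG0 A), G.IsPath α → G.IsPath β →
      pathWord α * (pathWord β)⁻¹ = g → ε * mono R G α A hA β = mono R G α A hA β)
    {t : LPABig R G} (ht : t ∈ fComp R G g) : ε * t = t := by
  induction ht using AddSubgroup.closure_induction with
  | mem x hx =>
    obtain ⟨l, α, β, A, hA, hα, hβ, hg, rfl⟩ := hx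
    rw [mul_smul_comm, h α β A hA hα hβ hg]
  | zero => exact mul_zero _
  | add x y _ _ hx hy => rw [mul_add, hx, hy]
  | neg x _ hx => exact (mul_neg ε x).trans (congrArg _ hx)

/-- If `ε` fixes all the monomials spanning `L_R(𝒢)_g` under right multiplication, it fixes
all of `L_R(𝒢)_g`. -/
theorem eq_mul_of_mem_fComp {g : FreeGroup E} {ε : LPABig R G}
    (h : ∀ (α β : List E) (A : Set V) (hA : G.InG0 A), G.IsPath α → G.IsPath β →
      pathWord α * (pathWord β)⁻¹ = g → mono R G α A hA β * ε = mono R G α A hA β)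
    {t : LPABig R G} (ht : t ∈ fComp R G g) : t * ε = t := by
  induction ht using AddSubgroup.closure_induction with
  | mem x hx =>
    obtain ⟨l, α, β, A, hA, hα, hβ, hg, rfl⟩ := hx
    rw [smul_mul_assoc, h α β A hA hα hβ hg]
  | zero => exact zero_mul _
  | add x y _ _ hx hy => rw [add_mul, hx, hy]
  | neg x _ hx => exact (neg_mul x ε).trans (congrArg _ hx)

theorem exists_eps (hU : G.InG0 Set.univ) (g : FreeGroup E) :
    ∃ ε ∈ mulSpan (fComp R G g) (fComp R G g⁻¹),
      (∀ t ∈ fComp R G g, ε * t = t) ∧ ∀ t ∈ fComp R G g⁻¹, t * ε = t := by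
  by_cases hg : ∃ a b : List E, G.IsPath a ∧ G.IsPath b ∧
      FreeGroup.IsReduced (diffWord a b) ∧ pathWord a * (pathWord b)⁻¹ = g
  · obtain ⟨a, b, ha, hb, hred, hab⟩ := hg
    have hba : pathWord b * (pathWord a)⁻¹ = g⁻¹ := by rw [← hab]; group
    refine ⟨mono R G a Set.univ hU b * mono R G b Set.univ hU a,
      AddSubgroup.subset_closure
        ⟨_, hab ▸ mono_mem_fComp (R := R) ha hb hU, _,
          hba ▸ mono_mem_fComp (R := R) hb ha hU, rfl⟩, ?_⟩
    have key : ∀ (α β : List E), pathWord α * (pathWord β)⁻¹ = g →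
        ∃ γ, α = a ++ γ ∧ β = b ++ γ := by
      intro α β hαβ
      obtain ⟨a', b', γ, rfl, rfl, hred'⟩ := exists_reduced_decomposition α β
      obtain ⟨rfl, rfl⟩ := diffWord_unique hred hred' (by
        rw [hab, ← hαβ, pathWord_append, pathWord_append]; group)
      exact ⟨γ, rfl, rfl⟩
    have ids := fun (γ : List E) (A : Set V) (hA : G.InG0 A) =>
      mul_identities (s := sPath R G a) (t := tPath R G a) (s' := sPath R G b)
        (t' := tPath R G b) (u := pgen R G Set.univ hU) (x := mono R G γ A hA γ)
        (tPath_mul_sPath_commute_mono hb γ hA) (tPath_mul_sPath_commute ha hb)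
        (tPath_mul_sPath a ha).2.1 (tPath_mul_sPath a ha).2.2
        (tPath_mul_sPath b hb).2.1 (tPath_mul_sPath b hb).2.2
        (pgen_univ_mul_mono hU γ hA γ)
        ((pgen_commute_mono hU γ hA).eq.symm.trans (pgen_univ_mul_mono hU γ hA γ))
        (tPath_mul_sPath_commute_pgen hU ha) (tPath_mul_sPath_commute_pgen hU hb)
    constructor
    · intro t ht
      refine mul_eq_of_mem_fComp (fun α β A hA _ _ hαβ => ?_) ht
      obtain ⟨γ, rfl, rfl⟩ := key α β hαβ
      rw [mono_append]
      exact (ids γ A hA).1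
    · intro t ht
      refine eq_mul_of_mem_fComp (fun β α A hA _ _ hβα => ?_) ht
      obtain ⟨γ, rfl, rfl⟩ := key α β (by rw [← inv_inv g, ← hβα]; group)
      rw [mono_append]
      exact (ids γ A hA).2
  · have hno : ∀ α β : List E, G.IsPath α → G.IsPath β →
        pathWord α * (pathWord β)⁻¹ ≠ g := by
      rintro α β hα hβ rfl
      obtain ⟨a, b, γ, rfl, rfl, hred⟩ := exists_reduced_decomposition α β
      refine hg ⟨a, b, (List.isChain_append.1 hα).1, (List.isChain_append.1 hβ).1, hred, ?_⟩
      rw [pathWord_append, pathWord_append]; group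
    refine ⟨0, zero_mem _, fun t ht => mul_eq_of_mem_fComp ?_ ht,
      fun t ht => eq_mul_of_mem_fComp ?_ ht⟩
    · intro α β _ _ hα hβ h
      exact absurd h (hno α β hα hβ)
    · intro β α _ _ hβ hα h
      exact absurd (by rw [← inv_inv g, ← h]; group) (hno α β hα hβ)

end Components

section Support

/-- Elements of `L_R(𝒢)_g` are annihilated on the right by the vertices outside some
member of `𝒢⁰`. -/
theorem exists_support_of_mem_fComp [Nonempty V] {g : FreeGroup E} {x : LPABig R G}
    (hx : x ∈ fComp R G g) :
    ∃ A, G.InG0 A ∧ ∀ v ∉ A, x * pgen R G {v} (InG0.vertex v) = 0 := by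
  induction hx using AddSubgroup.closure_induction with
  | mem x hx =>
    obtain ⟨l, α, β, A, hA, -, -, -, rfl⟩ := hx
    cases β with
    | nil =>
      refine ⟨A, hA, fun v hv => ?_⟩
      rw [smul_mul_assoc, mono]
      simp [tPath, mul_assoc, pgen_mul_pgen_vertex_of_notMem hA hv]
    | cons e β =>
      refine ⟨{G.src e}, InG0.vertex _, fun v hv => ?_⟩
      rw [smul_mul_assoc, mono, tPath_cons, mul_assoc, mul_assoc (tPath R G β),
        tgen_mul_pgen_of_notMem _ fun h => hv h.symm]
      simp
  | zero =>
    obtain ⟨v⟩ := ‹Nonempty V›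
    exact ⟨{v}, InG0.vertex v, fun _ _ => zero_mul _⟩
  | add x y _ _ hx hy =>
    obtain ⟨A, hA, hx⟩ := hx
    obtain ⟨B, hB, hy⟩ := hy
    refine ⟨A ∪ B, hA.union hB, fun v hv => ?_⟩
    rw [Set.mem_union, not_or] at hv
    rw [add_mul, hx v hv.1, hy v hv.2, add_zero]
  | neg x _ hx =>
    obtain ⟨A, hA, hx⟩ := hx
    exact ⟨A, hA, fun v hv =>
      (neg_mul x _).trans ((congrArg _ (hx v hv)).trans neg_zero)⟩

theorem exists_support_of_mem_mulSpan [Nonempty V] {g h : FreeGroup E} {x : LPABig R G}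
    (hx : x ∈ mulSpan (fComp R G g) (fComp R G h)) :
    ∃ A, G.InG0 A ∧ ∀ v ∉ A, x * pgen R G {v} (InG0.vertex v) = 0 := by
  induction hx using AddSubgroup.closure_induction with
  | mem x hx =>
    obtain ⟨a, -, b, hb, rfl⟩ := hx
    obtain ⟨A, hA, hx⟩ := exists_support_of_mem_fComp hb
    exact ⟨A, hA, fun v hv => by rw [mul_assoc, hx v hv, mul_zero]⟩
  | zero =>
    obtain ⟨v⟩ := ‹Nonempty V›
    exact ⟨{v}, InG0.vertex v, fun _ _ => zero_mul _⟩
  | add x y _ _ hx hy =>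
    obtain ⟨A, hA, hx⟩ := hx
    obtain ⟨B, hB, hy⟩ := hy
    refine ⟨A ∪ B, hA.union hB, fun v hv => ?_⟩
    rw [Set.mem_union, not_or] at hv
    rw [add_mul, hx v hv.1, hy v hv.2, add_zero]
  | neg x _ hx =>
    obtain ⟨A, hA, hx⟩ := hx
    exact ⟨A, hA, fun v hv =>
      (neg_mul x _).trans ((congrArg _ (hx v hv)).trans neg_zero)⟩

end Support

section Representation

/-- A branching system for `G` on `V × ℕ`: the set `T e ⊆ {s(e)} × ℕ` is in bijection with
`r(e) × ℕ` through `σ e`, with inverse `τ e`. -/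
structure BranchingSystem (G : Ultragraph V E) where
  /-- The piece of `V × ℕ` attached to an edge. -/
  T : E → Set (V × ℕ)
  /-- The bijection from `r(e) × ℕ` to `T e`. -/
  σ : E → V × ℕ → V × ℕ
  /-- The inverse bijection. -/
  τ : E → V × ℕ → V × ℕ
  σ_mem : ∀ e x, x.1 ∈ G.rng e → σ e x ∈ T e
  τ_σ : ∀ e x, x.1 ∈ G.rng e → τ e (σ e x) = x
  τ_mem : ∀ e, ∀ x ∈ T e, (τ e x).1 ∈ G.rng e
  σ_τ : ∀ e, ∀ x ∈ T e, σ e (τ e x) = x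
  src_eq : ∀ e, ∀ x ∈ T e, x.1 = G.src e
  disjoint : ∀ e f x, x ∈ T e → x ∈ T f → e = f
  cover : ∀ e x, G.src e = x.1 → ∃ f, x ∈ T f

theorem exists_branchingSystem [Countable V] [Countable E] (G : Ultragraph V E) :
    Nonempty (BranchingSystem G) := by
  classical
  have hc : ∀ v : V, ∃ c : ℕ → Option E, (∀ e, G.src e = v → {n | c n = some e}.Infinite) ∧
      (∀ n, ∀ e ∈ c n, G.src e = v) ∧ ((∃ e, G.src e = v) → ∀ n, ∃ e, c n = some e) := by
    intro v
    by_cases hv : ∃ e, G.src e = v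
    · obtain ⟨e₀, he₀⟩ := hv
      have : Nonempty {e // G.src e = v} := ⟨⟨e₀, he₀⟩⟩
      obtain ⟨u, hu⟩ := exists_surjective_nat {e // G.src e = v}
      refine ⟨fun n => some (u n.unpair.1), ?_, ?_, fun _ n => ⟨_, rfl⟩⟩
      · intro e he
        obtain ⟨k, hk⟩ := hu ⟨e, he⟩
        refine Set.infinite_of_injective_forall_mem (f := fun m => Nat.pair k m) ?_ ?_
        · intro m m' h
          exact (Nat.pair_eq_pair.1 h).2
        · intro m
          simp [hk]
      · intro n e he
        obtain rfl : (u n.unpair.1 : E) = e := by simpa using he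
        exact (u n.unpair.1).2
    · exact ⟨fun _ => none, fun e he => absurd ⟨e, he⟩ hv, by simp, fun h => absurd h hv⟩
  choose c hinf hsrc hcov using hc
  let S : E → Set (V × ℕ) := fun e => {x | x.1 ∈ G.rng e}
  let T : E → Set (V × ℕ) := fun e => {x | c x.1 x.2 = some e}
  have hS : ∀ e, Infinite (S e) := by
    intro e
    obtain ⟨v, hv⟩ := G.rng_nonempty e
    exact Infinite.of_injective (fun n : ℕ => (⟨(v, n), hv⟩ : S e))
      fun m n h => by simpa using h
  have hT : ∀ e, Infinite (T e) := by
    intro e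
    have := (hinf _ e rfl).to_subtype
    exact Infinite.of_injective
      (fun n : {n | c (G.src e) n = some e} => (⟨(G.src e, n), n.2⟩ : T e))
      fun m n h => by simpa [Subtype.ext_iff] using h
  have φ : ∀ e, S e ≃ T e := fun e =>
    have := hS e
    have := hT e
    Classical.choice nonempty_equiv_of_countable
  exact ⟨{
    T := T
    σ := fun e x => if h : x ∈ S e then φ e ⟨x, h⟩ else x
    τ := fun e x => if h : x ∈ T e then (φ e).symm ⟨x, h⟩ else x
    σ_mem := fun e x hx => by
      have hx : x ∈ S e := hx
      simp only [hx, dite_true]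
      exact (φ e ⟨x, hx⟩).2
    τ_σ := fun e x hx => by
      have hx : x ∈ S e := hx
      simp [hx]
    τ_mem := fun e x hx => by
      simp only [hx, dite_true]
      exact ((φ e).symm ⟨x, hx⟩).2
    σ_τ := fun e x hx => by
      simp [hx]
    src_eq := fun e x hx => (hsrc _ _ e hx).symm
    disjoint := fun e f x he hf => Option.some.inj (he.symm.trans hf)
    cover := fun e x he => hcov _ ⟨e, he⟩ _ }⟩

open Classical in
/-- The operator on functions which precomposes with `φ` on `S` and vanishes off `S`. -/
noncomputable def compOn (R : Type) [CommRing R] {X : Type} (S : Set X) (φ : X → X) :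
    Module.End R (X → R) where
  toFun f x := if x ∈ S then f (φ x) else 0
  map_add' f g := by ext x; by_cases h : x ∈ S <;> simp [h]
  map_smul' r f := by ext x; by_cases h : x ∈ S <;> simp [h]

open Classical in
theorem compOn_apply {X : Type} (S : Set X) (φ : X → X) (f : X → R) (x : X) :
    compOn R S φ f x = if x ∈ S then f (φ x) else 0 := rfl

/-- The operators by which the generators act in the representation attached to a
branching system. -/
noncomputable def BranchingSystem.genOp (R : Type) [CommRing R] (B : BranchingSystem G) :
    LPAGen G → Module.End R (V × ℕ → R)
  | .edge e => compOn R (B.T e) (B.τ e)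
  | .star e => compOn R {x | x.1 ∈ G.rng e} (B.σ e)
  | .proj A _ => compOn R {x | x.1 ∈ A} id

theorem BranchingSystem.lift_genOp_eq (B : BranchingSystem G) ⦃x y : FA R G⦄
    (h : LeavittRel R G x y) :
    FreeAlgebra.lift R (B.genOp R) x = FreeAlgebra.lift R (B.genOp R) y := by
  classical
  cases h <;> simp only [X, map_mul, map_add, map_sub, map_zero, map_sum,
    FreeAlgebra.lift_ι_apply, BranchingSystem.genOp] <;> ext f x
  case proj_empty => simp [compOn_apply]
  case proj_mul A C _ _ =>
    by_cases hA : x.1 ∈ A <;> simp [compOn_apply, hA]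
  case proj_union A C _ _ =>
    by_cases hA : x.1 ∈ A <;> by_cases hC : x.1 ∈ C <;> simp [compOn_apply, hA, hC]
  case src_mul e =>
    by_cases hx : x ∈ B.T e
    · simp [compOn_apply, hx, B.src_eq e x hx]
    · simp [compOn_apply, hx]
  case mul_rng e =>
    by_cases hx : x ∈ B.T e
    · simp [compOn_apply, hx, B.τ_mem e x hx]
    · simp [compOn_apply, hx]
  case rng_mul_star e =>
    by_cases hx : x.1 ∈ G.rng e <;> simp [compOn_apply, hx]
  case star_mul_src e =>
    by_cases hx : x.1 ∈ G.rng e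
    · simp [compOn_apply, hx, B.src_eq e _ (B.σ_mem e x hx)]
    · simp [compOn_apply, hx]
  case star_mul_same e =>
    by_cases hx : x.1 ∈ G.rng e
    · simp [compOn_apply, hx, B.σ_mem e x hx, B.τ_σ e x hx]
    · simp [compOn_apply, hx]
  case star_mul_ne e e' hne =>
    by_cases hx : x.1 ∈ G.rng e
    · have hx' : B.σ e x ∉ B.T e' := fun hx' => hne (B.disjoint _ _ _ (B.σ_mem e x hx) hx')
      simp [compOn_apply, hx, hx']
    · simp [compOn_apply, hx]
  case ck v hfin hne =>
    rw [LinearMap.sum_apply, Finset.sum_apply]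
    by_cases hv : x.1 = v
    · obtain ⟨e₀, he₀⟩ := hne
      obtain ⟨e, he⟩ := B.cover e₀ x (he₀.trans hv.symm)
      rw [Finset.sum_eq_single e]
      · simp [compOn_apply, hv, he, B.τ_mem e x he, B.σ_τ e x he]
      · intro e' _ hne'
        have hx : x ∉ B.T e' := fun hx => hne' (B.disjoint _ _ _ hx he)
        simp [compOn_apply, hx]
      · intro hmem
        exact absurd (hfin.mem_toFinset.2 ((B.src_eq e x he).symm.trans hv)) hmem
    · rw [Finset.sum_eq_zero]
      · simp [compOn_apply, hv]
      · intro e he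
        have hx : x ∉ B.T e := fun hx =>
          hv ((B.src_eq e x hx).trans (hfin.mem_toFinset.1 he))
        simp [compOn_apply, hx]

theorem pgen_vertex_ne_zero [Nontrivial R] [Countable V] [Countable E] (v : V) :
    pgen R G {v} (InG0.vertex v) ≠ 0 := by
  obtain ⟨B⟩ := exists_branchingSystem G
  intro h
  have h' := congrArg (RingQuot.liftAlgHom R ⟨FreeAlgebra.lift R (B.genOp R), B.lift_genOp_eq⟩) h
  rw [pgen, gen, RingQuot.liftAlgHom_mkAlgHom_apply, map_zero, X, FreeAlgebra.lift_ι_apply] at h'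
  have h'' := congrFun (LinearMap.congr_fun h' fun _ => 1) (v, 0)
  simp [BranchingSystem.genOp, compOn_apply] at h''

end Representation

end Ultragraph

open Ultragraph in
/-- `L_R(𝒢)` is epsilon-strongly graded by the free group on the edges
iff `G⁰ ∈ 𝒢⁰`. -/
theorem epsilonStrongF_iff_univ_mem {V E : Type} [Countable V] [Countable E]
    (G : Ultragraph V E) [Nonempty E] (R : Type) [CommRing R] [Nontrivial R] :
    (∃ eps : FreeGroup E → LPABig R G, ∀ g : FreeGroup E,
        eps g ∈ mulSpan (fComp R G g) (fComp R G g⁻¹) ∧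
        ∀ t ∈ fComp R G g, eps g * t = t ∧ t * eps g⁻¹ = t) ↔
      G.InG0 Set.univ := by
  constructor
  · rintro ⟨eps, heps⟩
    have : Nonempty V := ‹Nonempty E›.map G.src
    obtain ⟨A, hA, hsupp⟩ := exists_support_of_mem_mulSpan (heps 1).1
    suffices A = Set.univ from this ▸ hA
    refine Set.eq_univ_of_forall fun v => by_contra fun hv => ?_
    refine pgen_vertex_ne_zero (R := R) (G := G) v ?_
    rw [← hsupp v hv, ((heps 1).2 _ _).1]
    have h := mono_mem_fComp (R := R) (α := []) (β := []) List.isChain_nil List.isChain_nil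
      (InG0.vertex (G := G) v)
    simpa [mono, sPath, tPath, pathWord] using h
  · intro hU
    choose eps hmem hl hr using exists_eps (R := R) hU
    exact ⟨eps, fun g => ⟨hmem g, fun t ht =>
      ⟨hl g t ht, hr g⁻¹ t (by rwa [inv_inv])⟩⟩⟩
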